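/- Fix -1 = t₀ < t₁ < ⋯ < t_n < t_{n+1} = 1 and nonnegative reals p₀, …, p_n with Σ_{i=0}^{n} (t_{i+1}-t_i) p_i = 1, and let μ be the Borel probability measure on [-1,1] with piecewise constant density equal to p_i on [t_i, t_{i+1}). Let ε > 0 and let g : [-ε, ε] → ℝ be a continuous piecewise 1-differentiable function, strictly decreasing on [-ε, 0] and strictly increasing on [0, ε], such that the finite one-sided limits L = lim_{x→0⁻} g′(x) and R = lim_{x→0⁺} g′(x) exist. For 0 ≤ i ≤ n+1 set X_i = L·μ([-1, t_i]) + R·μ([t_i, 1]). If for every i ∈ {0, 1, …, n} at least one of the numbers X_i and X_{i+1} is nonzero, then the germ of g at 0 is topologically stable at 0 with respect to averagings by μ. -/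

import Mathlib

open MeasureTheory Set Filter

/-- The `α`-averaging of `f` by the measure `μ` (supported on `[-1,1]`):
`f_α(x) = ∫ f(x + tα) dμ(t)`. -/
noncomputable def avg (μ : Measure ℝ) (f : ℝ → ℝ) (α : ℝ) (x : ℝ) : ℝ :=
  ∫ t, f (x + t * α) ∂μ

/-- The measure on `ℝ` with piecewise constant density taking the value `p i`
on `[t i, t (i+1))`. -/
noncomputable def stepMeasure (n : ℕ) (t : Fin (n + 2) → ℝ) (p : Fin (n + 1) → ℝ) :
    Measure ℝ :=
  volume.withDensity fun x =>
    ENNReal.ofReal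
      (∑ i : Fin (n + 1), Set.indicator (Ico (t i.castSucc) (t i.succ)) (fun _ => p i) x)

/-- `f` is continuous on `[a,b]` and piecewise `k`-differentiable with (finite) break set
`S ⊂ (a,b)`. -/
def PiecewiseDiffOn (k : ℕ) (f : ℝ → ℝ) (a b : ℝ) (S : Set ℝ) : Prop :=
  ContinuousOn f (Icc a b) ∧ S.Finite ∧ S ⊆ Ioo a b ∧
  ContDiffOn ℝ k f (Icc a b \ S) ∧
  ∀ j : ℕ, 1 ≤ j → j ≤ k → ∀ s ∈ S,
    (∃ l : ℝ, Tendsto (iteratedDerivWithin j f (Icc a b \ S))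
      (nhdsWithin s (Iio s)) (nhds l)) ∧
    (∃ r : ℝ, Tendsto (iteratedDerivWithin j f (Icc a b \ S))
      (nhdsWithin s (Ioi s)) (nhds r))

/-- An orientation preserving homeomorphism of `ℝ`: a strictly increasing continuous
surjection `ℝ → ℝ`. -/
def OrientHomeo (φ : ℝ → ℝ) : Prop :=
  Continuous φ ∧ StrictMono φ ∧ Function.Surjective φ

/-- Topological equivalence of `f` restricted to `(a,b)` and `g` restricted to `(c,d)`. -/
def TopEquivOn (f : ℝ → ℝ) (a b : ℝ) (g : ℝ → ℝ) (c d : ℝ) : Prop :=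
  ∃ h φ : ℝ → ℝ,
    ContinuousOn h (Ioo a b) ∧ StrictMonoOn h (Ioo a b) ∧
    BijOn h (Ioo a b) (Ioo c d) ∧
    OrientHomeo φ ∧
    ∀ x ∈ Ioo a b, φ (f x) = g (h x)

/-- The germ of `f` at `a` is topologically stable with respect to averagings by `μ`. -/
def TopStableAt (μ : Measure ℝ) (f : ℝ → ℝ) (a : ℝ) : Prop :=
  ∃ ε > 0, ∀ α ∈ Ioo (0 : ℝ) ε,
    ∃ c₁ c₂ d₁ d₂ : ℝ,
      c₁ ∈ Ioo (a - ε) (a + ε) ∧ c₂ ∈ Ioo (a - ε) (a + ε) ∧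
      d₁ ∈ Ioo (a - ε) (a + ε) ∧ d₂ ∈ Ioo (a - ε) (a + ε) ∧
      c₁ < a ∧ a < c₂ ∧ d₁ < d₂ ∧
      TopEquivOn f c₁ c₂ (avg μ f α) d₁ d₂

theorem exists_strictMonoOn_conj {u v : ℝ → ℝ} {a b ρ σ : ℝ} (hρ : 0 < ρ) (hσ : 0 < σ)
    (hu : ContinuousOn u (Icc (a - ρ) (a + ρ))) (hum : StrictMonoOn u (Icc (a - ρ) (a + ρ)))
    (hua : u a = 0)
    (hv : ContinuousOn v (Icc (b - σ) (b + σ))) (hvm : StrictMonoOn v (Icc (b - σ) (b + σ)))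
    (hvb : v b = 0) :
    ∃ c₁ ∈ Ioo (a - ρ) a, ∃ c₂ ∈ Ioo a (a + ρ), ∃ d₁ ∈ Ioo (b - σ) b, ∃ d₂ ∈ Ioo b (b + σ),
      ∃ h : ℝ → ℝ, ContinuousOn h (Ioo c₁ c₂) ∧ StrictMonoOn h (Ioo c₁ c₂) ∧
        BijOn h (Ioo c₁ c₂) (Ioo d₁ d₂) ∧ ∀ x ∈ Ioo c₁ c₂, v (h x) = u x := by
  have level : ∀ {w : ℝ → ℝ} {e r δ : ℝ}, 0 < r → ContinuousOn w (Icc (e - r) (e + r)) →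
      StrictMonoOn w (Icc (e - r) (e + r)) → w e = 0 → 0 < δ → δ < w (e + r) →
      w (e - r) < -δ → ∃ x₁ ∈ Ioo (e - r) e, ∃ x₂ ∈ Ioo e (e + r),
        BijOn w (Ioo x₁ x₂) (Ioo (-δ) δ) := by
    intro w e r δ hr hw hwm hwe hδ h1 h2
    obtain ⟨x₁, hx₁, hwx₁⟩ := intermediate_value_Ioo (by linarith : e - r ≤ e)
      (hw.mono (Icc_subset_Icc_right (by linarith))) (show -δ ∈ Ioo (w (e - r)) (w e) from
        ⟨h2, by linarith⟩)
    obtain ⟨x₂, hx₂, hwx₂⟩ := intermediate_value_Ioo (by linarith : e ≤ e + r)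
      (hw.mono (Icc_subset_Icc_left (by linarith))) (show δ ∈ Ioo (w e) (w (e + r)) from
        ⟨by linarith, h1⟩)
    have hsub : Icc x₁ x₂ ⊆ Icc (e - r) (e + r) := Icc_subset_Icc hx₁.1.le hx₂.2.le
    have h12 : x₁ ≤ x₂ := (hx₁.2.trans hx₂.1).le
    refine ⟨x₁, hx₁, x₂, hx₂, ?_, (hwm.mono (Ioo_subset_Icc_self.trans hsub)).injOn, ?_⟩
    · intro x hx
      rw [← hwx₁, ← hwx₂]
      exact ⟨hwm (hsub (left_mem_Icc.2 h12)) (hsub (Ioo_subset_Icc_self hx)) hx.1,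
        hwm (hsub (Ioo_subset_Icc_self hx)) (hsub (right_mem_Icc.2 h12)) hx.2⟩
    · have := intermediate_value_Ioo h12 (hw.mono hsub)
      rwa [hwx₁, hwx₂] at this
  have hu1 : 0 < u (a + ρ) := by
    rw [← hua]; exact hum ⟨by linarith, by linarith⟩ ⟨by linarith, by linarith⟩ (by linarith)
  have hu2 : u (a - ρ) < 0 := by
    rw [← hua]; exact hum ⟨by linarith, by linarith⟩ ⟨by linarith, by linarith⟩ (by linarith)
  have hv1 : 0 < v (b + σ) := by
    rw [← hvb]; exact hvm ⟨by linarith, by linarith⟩ ⟨by linarith, by linarith⟩ (by linarith)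
  have hv2 : v (b - σ) < 0 := by
    rw [← hvb]; exact hvm ⟨by linarith, by linarith⟩ ⟨by linarith, by linarith⟩ (by linarith)
  obtain ⟨δ, hδ, hδ'⟩ : ∃ δ > 0, δ < min (min (u (a + ρ)) (-u (a - ρ)))
      (min (v (b + σ)) (-v (b - σ))) :=
    exists_between (by simp [*])
  simp only [lt_min_iff] at hδ'
  obtain ⟨c₁, hc₁, c₂, hc₂, hbu⟩ := level hρ hu hum hua hδ hδ'.1.1 (by linarith [hδ'.1.2])
  obtain ⟨d₁, hd₁, d₂, hd₂, hbv⟩ := level hσ hv hvm hvb hδ hδ'.2.1 (by linarith [hδ'.2.2])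
  have hinv := hbv.invOn_invFunOn
  have hbh : BijOn (Function.invFunOn v (Ioo d₁ d₂) ∘ u) (Ioo c₁ c₂) (Ioo d₁ d₂) :=
    (BijOn.symm hinv.symm hbv).comp hbu
  have hconj : ∀ x ∈ Ioo c₁ c₂, v ((Function.invFunOn v (Ioo d₁ d₂) ∘ u) x) = u x :=
    fun x hx => hinv.2 (hbu.mapsTo hx)
  have hsubv : Ioo d₁ d₂ ⊆ Icc (b - σ) (b + σ) :=
    Ioo_subset_Icc_self.trans (Icc_subset_Icc hd₁.1.le hd₂.2.le)
  have hsubu : Ioo c₁ c₂ ⊆ Icc (a - ρ) (a + ρ) :=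
    Ioo_subset_Icc_self.trans (Icc_subset_Icc hc₁.1.le hc₂.2.le)
  have hmono : StrictMonoOn (Function.invFunOn v (Ioo d₁ d₂) ∘ u) (Ioo c₁ c₂) := by
    intro x hx y hy hxy
    rw [← hvm.lt_iff_lt (hsubv (hbh.mapsTo hx)) (hsubv (hbh.mapsTo hy)), hconj x hx, hconj y hy]
    exact hum (hsubu hx) (hsubu hy) hxy
  refine ⟨c₁, hc₁, c₂, hc₂, d₁, hd₁, d₂, hd₂, _, fun x hx => ?_, hmono, hbh, hconj⟩
  refine (hmono.continuousAt_of_image_mem_nhds (Ioo_mem_nhds hx.1 hx.2) ?_).continuousWithinAt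
  rw [hbh.image_eq]
  exact Ioo_mem_nhds (hbh.mapsTo hx).1 (hbh.mapsTo hx).2

/-- A valley with bottom `a`: continuous, strictly decreasing, then strictly increasing. -/
structure IsValleyOn (f : ℝ → ℝ) (a ρ : ℝ) : Prop where
  continuousOn : ContinuousOn f (Icc (a - ρ) (a + ρ))
  strictAntiOn : StrictAntiOn f (Icc (a - ρ) a)
  strictMonoOn : StrictMonoOn f (Icc a (a + ρ))

/-- The height of `f` above `f a`, counted negatively to the left of `a`. -/
noncomputable def signedHeight (f : ℝ → ℝ) (a x : ℝ) : ℝ :=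
  if x ≤ a then f a - f x else f x - f a

theorem signedHeight_self (f : ℝ → ℝ) (a : ℝ) : signedHeight f a a = 0 := by
  simp [signedHeight]

theorem IsValleyOn.abs_signedHeight {f : ℝ → ℝ} {a ρ x : ℝ} (hf : IsValleyOn f a ρ) (hρ : 0 < ρ)
    (hx : x ∈ Icc (a - ρ) (a + ρ)) : |signedHeight f a x| = f x - f a := by
  unfold signedHeight
  split_ifs with h
  · have := hf.strictAntiOn.antitoneOn ⟨hx.1, h⟩ (right_mem_Icc.2 (by linarith)) h
    rw [abs_of_nonpos (by linarith)]; ring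
  · have := hf.strictMonoOn.monotoneOn (left_mem_Icc.2 (by linarith)) ⟨(not_le.1 h).le, hx.2⟩
      (not_le.1 h).le
    rw [abs_of_nonneg (by linarith)]

theorem IsValleyOn.strictMonoOn_signedHeight {f : ℝ → ℝ} {a ρ : ℝ} (hf : IsValleyOn f a ρ) :
    StrictMonoOn (signedHeight f a) (Icc (a - ρ) (a + ρ)) := by
  intro x hx y hy hxy
  unfold signedHeight
  split_ifs with h h' h'
  · linarith [hf.strictAntiOn ⟨hx.1, h⟩ ⟨hy.1, h'⟩ hxy]
  · have h'' := not_le.1 h'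
    have h1 := hf.strictAntiOn.antitoneOn ⟨hx.1, h⟩ ⟨hx.1.trans h, le_rfl⟩ h
    have h2 := hf.strictMonoOn ⟨le_rfl, h''.le.trans hy.2⟩ ⟨h''.le, hy.2⟩ h''
    linarith
  · linarith
  · linarith [hf.strictMonoOn ⟨(not_le.1 h).le, hx.2⟩ ⟨(not_le.1 h').le, hy.2⟩ hxy]

theorem IsValleyOn.continuousOn_signedHeight {f : ℝ → ℝ} {a ρ : ℝ} (hf : IsValleyOn f a ρ) :
    ContinuousOn (signedHeight f a) (Icc (a - ρ) (a + ρ)) := by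
  unfold signedHeight
  refine ContinuousOn.if ?_ ?_ ?_
  · rintro x ⟨-, hx⟩
    have : x = a := by
      change x ∈ frontier (Iic a) at hx
      simpa using hx
    simp [this]
  · exact (continuousOn_const.sub hf.continuousOn).mono inter_subset_left
  · exact (hf.continuousOn.sub continuousOn_const).mono inter_subset_left

theorem IsValleyOn.exists_topEquivOn {f g : ℝ → ℝ} {a b ρ σ : ℝ} (hρ : 0 < ρ) (hσ : 0 < σ)
    (hf : IsValleyOn f a ρ) (hg : IsValleyOn g b σ) :
    ∃ c₁ ∈ Ioo (a - ρ) a, ∃ c₂ ∈ Ioo a (a + ρ), ∃ d₁ ∈ Ioo (b - σ) b, ∃ d₂ ∈ Ioo b (b + σ),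
      TopEquivOn f c₁ c₂ g d₁ d₂ := by
  obtain ⟨c₁, hc₁, c₂, hc₂, d₁, hd₁, d₂, hd₂, h, hcont, hmono, hbij, hconj⟩ :=
    exists_strictMonoOn_conj hρ hσ hf.continuousOn_signedHeight hf.strictMonoOn_signedHeight
      (signedHeight_self f a) hg.continuousOn_signedHeight hg.strictMonoOn_signedHeight
      (signedHeight_self g b)
  refine ⟨c₁, hc₁, c₂, hc₂, d₁, hd₁, d₂, hd₂, h, fun y => y + (g b - f a), hcont, hmono, hbij,
    ⟨by fun_prop, fun x y hxy => by simpa using hxy, fun y => ⟨y - (g b - f a), by ring⟩⟩,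
    fun x hx => ?_⟩
  have h1 := hf.abs_signedHeight hρ (x := x) ⟨hc₁.1.le.trans hx.1.le, hx.2.le.trans hc₂.2.le⟩
  have hy := hbij.mapsTo hx
  have h2 := hg.abs_signedHeight hσ (x := h x) ⟨hd₁.1.le.trans hy.1.le, hy.2.le.trans hd₂.2.le⟩
  rw [hconj x hx] at h2
  linarith

theorem stepMeasure_eq_sum (n : ℕ) (t : Fin (n + 2) → ℝ) (p : Fin (n + 1) → ℝ)
    (hp : ∀ i, 0 ≤ p i) :
    stepMeasure n t p =
      ∑ i, ENNReal.ofReal (p i) • volume.restrict (Ico (t i.castSucc) (t i.succ)) := by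
  ext s hs
  have hind : ∀ x, ENNReal.ofReal
      (∑ i : Fin (n + 1), Set.indicator (Ico (t i.castSucc) (t i.succ)) (fun _ => p i) x) =
      ∑ i, Set.indicator (Ico (t i.castSucc) (t i.succ)) (fun _ => ENNReal.ofReal (p i)) x := by
    intro x
    rw [ENNReal.ofReal_sum_of_nonneg fun i _ => indicator_nonneg (fun _ _ => hp i) x]
    refine Finset.sum_congr rfl fun i _ => ?_
    by_cases hx : x ∈ Ico (t i.castSucc) (t i.succ) <;> simp [hx]
  rw [stepMeasure, withDensity_apply _ hs]
  simp_rw [hind]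
  rw [lintegral_finsetSum _ fun i _ => measurable_const.indicator measurableSet_Ico]
  simp [lintegral_indicator measurableSet_Ico, Measure.restrict_apply hs, inter_comm]

theorem toReal_stepMeasure_apply (n : ℕ) (t : Fin (n + 2) → ℝ) (p : Fin (n + 1) → ℝ)
    (hp : ∀ i, 0 ≤ p i) {s : Set ℝ} (hs : MeasurableSet s) :
    (stepMeasure n t p s).toReal =
      ∑ i, p i * (volume (s ∩ Ico (t i.castSucc) (t i.succ))).toReal := by
  rw [stepMeasure_eq_sum n t p hp, Measure.finsetSum_apply, ENNReal.toReal_sum]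
  · simp [Measure.restrict_apply hs, hp]
  · intro i _
    simp only [Measure.smul_apply, smul_eq_mul, Measure.restrict_apply hs]
    exact ENNReal.mul_ne_top ENNReal.ofReal_ne_top
      ((measure_mono inter_subset_right).trans_lt measure_Ico_lt_top).ne

theorem integral_stepMeasure (n : ℕ) (t : Fin (n + 2) → ℝ) (p : Fin (n + 1) → ℝ)
    (ht : Monotone t) (hp : ∀ i, 0 ≤ p i) {f : ℝ → ℝ}
    (hf : ContinuousOn f (Icc (t 0) (t (Fin.last (n + 1))))) :
    ∫ x, f x ∂stepMeasure n t p = ∑ i, p i * ∫ x in t i.castSucc..t i.succ, f x := by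
  rw [stepMeasure_eq_sum n t p hp, integral_finsetSum_measure]
  · refine Finset.sum_congr rfl fun i _ => ?_
    rw [integral_smul_measure, integral_Ico_eq_integral_Ioc,
      intervalIntegral.integral_of_le (ht i.castSucc_le_succ), ENNReal.toReal_ofReal (hp i),
      smul_eq_mul]
  · intro i _
    refine Integrable.smul_measure ?_ ENNReal.ofReal_ne_top
    have hsub := Icc_subset_Icc (ht (Fin.zero_le i.castSucc)) (ht (Fin.le_last i.succ))
    exact (hf.mono hsub).integrableOn_Icc.mono_set Ico_subset_Icc_self

theorem toReal_stepMeasure_Icc_left (n : ℕ) (t : Fin (n + 2) → ℝ) (p : Fin (n + 1) → ℝ)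
    (ht : StrictMono t) (hp : ∀ i, 0 ≤ p i) (j : Fin (n + 2)) :
    (stepMeasure n t p (Icc (t 0) (t j))).toReal =
      ∑ i, if i.castSucc < j then p i * (t i.succ - t i.castSucc) else 0 := by
  rw [toReal_stepMeasure_apply n t p hp measurableSet_Icc]
  refine Finset.sum_congr rfl fun i _ => ?_
  have h0 : t 0 ≤ t i.castSucc := ht.monotone (Fin.zero_le _)
  split_ifs with h
  · have h1 : t i.succ ≤ t j := ht.monotone (Fin.castSucc_lt_iff_succ_le.1 h)
    have h2 := ht.monotone i.castSucc_le_succ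
    rw [inter_eq_right.2 (show Ico _ _ ⊆ Icc _ _ from
      fun x hx => ⟨h0.trans hx.1, hx.2.le.trans h1⟩), Real.volume_Ico,
      ENNReal.toReal_ofReal (by linarith)]
  · have h1 : t j ≤ t i.castSucc := ht.monotone (not_lt.1 h)
    have : Icc (t 0) (t j) ∩ Ico (t i.castSucc) (t i.succ) ⊆ {t j} :=
      fun x hx => le_antisymm hx.1.2 (h1.trans hx.2.1)
    rw [measure_mono_null this (by simp)]
    simp

theorem toReal_stepMeasure_Icc_right (n : ℕ) (t : Fin (n + 2) → ℝ) (p : Fin (n + 1) → ℝ)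
    (ht : StrictMono t) (hp : ∀ i, 0 ≤ p i) (j : Fin (n + 2)) :
    (stepMeasure n t p (Icc (t j) (t (Fin.last (n + 1))))).toReal =
      ∑ i, if i.castSucc < j then 0 else p i * (t i.succ - t i.castSucc) := by
  rw [toReal_stepMeasure_apply n t p hp measurableSet_Icc]
  refine Finset.sum_congr rfl fun i _ => ?_
  have h0 : t i.succ ≤ t (Fin.last (n + 1)) := ht.monotone (Fin.le_last _)
  split_ifs with h
  · have h1 : t i.succ ≤ t j := ht.monotone (Fin.castSucc_lt_iff_succ_le.1 h)
    have : Icc (t j) (t (Fin.last (n + 1))) ∩ Ico (t i.castSucc) (t i.succ) ⊆ ∅ :=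
      fun x hx => absurd (hx.2.2.trans_le h1) (not_lt.2 hx.1.1)
    rw [measure_mono_null this (by simp)]
    simp
  · have h1 : t j ≤ t i.castSucc := ht.monotone (not_lt.1 h)
    have h2 := ht.monotone i.castSucc_le_succ
    rw [inter_eq_right.2 (show Ico _ _ ⊆ Icc _ _ from
      fun x hx => ⟨h1.trans hx.1, hx.2.le.trans h0⟩), Real.volume_Ico,
      ENNReal.toReal_ofReal (by linarith)]

theorem hasDerivAt_sum_integral (n : ℕ) (t : Fin (n + 2) → ℝ) (p : Fin (n + 1) → ℝ) {f : ℝ → ℝ}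
    (hf : Continuous f) {α : ℝ} (hα : α ≠ 0) (x : ℝ) :
    HasDerivAt (fun x => ∑ i, p i * ∫ s in t i.castSucc..t i.succ, f (x + s * α))
      (α⁻¹ * ∑ i, p i * (f (x + t i.succ * α) - f (x + t i.castSucc * α))) x := by
  have key : ∀ i : Fin (n + 1), HasDerivAt (fun x => ∫ s in t i.castSucc..t i.succ, f (x + s * α))
      (α⁻¹ * (f (x + t i.succ * α) - f (x + t i.castSucc * α))) x := by
    intro i
    have hG : ∀ y, HasDerivAt (fun u => ∫ s in (0 : ℝ)..u, f s) (f y) y := fun y =>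
      intervalIntegral.integral_hasDerivAt_right (hf.intervalIntegrable _ _)
        hf.aestronglyMeasurable.stronglyMeasurableAtFilter hf.continuousAt
    have heq : (fun x => ∫ s in t i.castSucc..t i.succ, f (x + s * α)) = fun x => α⁻¹ *
        ((∫ s in (0 : ℝ)..(x + t i.succ * α), f s) -
          ∫ s in (0 : ℝ)..(x + t i.castSucc * α), f s) := by
      funext x
      rw [intervalIntegral.integral_interval_sub_left (hf.intervalIntegrable _ _)
        (hf.intervalIntegrable _ _)]
      simp_rw [mul_comm _ α]
      rw [intervalIntegral.integral_comp_add_mul f hα, smul_eq_mul]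
    rw [heq]
    exact (((hG _).comp_add_const x _).sub ((hG _).comp_add_const x _)).const_mul _
  rw [Finset.mul_sum]
  refine (HasDerivAt.fun_sum fun i _ => (key i).const_mul (p i)).congr_deriv ?_
  exact Finset.sum_congr rfl fun i _ => by ring

theorem exists_mem_Icc_castSucc_succ {n : ℕ} {t : Fin (n + 2) → ℝ} (ht : Monotone t) {s : ℝ}
    (h0 : t 0 ≤ s) (h1 : s ≤ t (Fin.last (n + 1))) :
    ∃ j : Fin (n + 1), s ∈ Icc (t j.castSucc) (t j.succ) := by
  have key : ∀ k : Fin (n + 2), s ≤ t k → ∃ j : Fin (n + 1), s ∈ Icc (t j.castSucc) (t j.succ) := by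
    intro k
    induction k using Fin.induction with
    | zero => exact fun hs => ⟨0, h0, hs.trans (ht (Fin.zero_le _))⟩
    | succ k ih =>
      intro hs
      rcases le_total s (t k.castSucc) with h | h
      · exact ih h
      · exact ⟨k, h, hs⟩
  exact key _ h1

/-- A function which is close to `X` at the nodes and whose slope on each cell is close to
`-κ * p j` has at most one zero. -/
theorem exists_pos_forall_zero_unique {n : ℕ} {t : Fin (n + 2) → ℝ} {p : Fin (n + 1) → ℝ}
    {X : Fin (n + 2) → ℝ} {κ : ℝ} (ht : StrictMono t) (hp : ∀ i, 0 ≤ p i) (hκ : 0 < κ)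
    (hX : Antitone X) (hnonzero : ∀ i : Fin (n + 1), X i.castSucc ≠ 0 ∨ X i.succ ≠ 0) :
    ∃ η > 0, ∀ D : ℝ → ℝ, (∀ j, |D (t j) - X j| ≤ η) →
      (∀ j : Fin (n + 1), ∀ s ∈ Icc (t j.castSucc) (t j.succ), ∀ s' ∈ Icc (t j.castSucc) (t j.succ),
        s ≤ s' → |D s - D s' - κ * p j * (s' - s)| ≤ η * (s' - s)) →
      InjOn D (Icc (t 0) (t (Fin.last (n + 1))) ∩ {s | D s = 0}) := by
  set T := t (Fin.last (n + 1)) - t 0 with hT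
  have hsmall : ∀ c : ℝ, 0 < c → ∀ᶠ η in nhdsWithin (0 : ℝ) (Ioi 0), η * (1 + T) < c := by
    intro c hc
    have : Tendsto (fun η : ℝ => η * (1 + T)) (nhdsWithin 0 (Ioi 0)) (nhds (0 * (1 + T))) :=
      (tendsto_id.mono_left nhdsWithin_le_nhds).mul_const _
    rw [zero_mul] at this
    exact this.eventually (gt_mem_nhds hc)
  have hev : ∀ᶠ η in nhdsWithin (0 : ℝ) (Ioi 0), 0 < η ∧
      (∀ j, 0 < p j → η * (1 + T) < κ * p j) ∧ ∀ j, X j ≠ 0 → η * (1 + T) < |X j| := by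
    refine (eventually_mem_nhdsWithin).and ((eventually_all.2 fun j => ?_).and
      (eventually_all.2 fun j => ?_))
    · by_cases h : 0 < p j
      · exact (hsmall _ (mul_pos hκ h)).mono fun _ h' _ => h'
      · simp [h]
    · by_cases h : X j = 0
      · simp [h]
      · exact (hsmall _ (abs_pos.2 h)).mono fun _ h' _ => h'
  obtain ⟨η, hη, hηp, hηX⟩ := hev.exists
  refine ⟨η, hη, fun D hnode hslope => ?_⟩
  have hT0 : 0 ≤ T := sub_nonneg.2 (ht.monotone (Fin.zero_le _))
  have hηT : 0 ≤ η * T := mul_nonneg hη.le hT0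
  have hpos : ∀ j, 0 ≤ D (t j) → 0 ≤ X j := by
    intro j hD
    by_contra! h
    have h1 := hηX j h.ne
    rw [abs_of_neg h] at h1
    linarith [(abs_le.1 (hnode j)).2]
  have hneg : ∀ j, D (t j) ≤ 0 → X j ≤ 0 := by
    intro j hD
    by_contra! h
    have h1 := hηX j h.ne'
    rw [abs_of_pos h] at h1
    linarith [(abs_le.1 (hnode j)).1]
  have hlen : ∀ j : Fin (n + 1), t j.succ - t j.castSucc ≤ T := fun j =>
    sub_le_sub (ht.monotone (Fin.le_last _)) (ht.monotone (Fin.zero_le _))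
  have hpj : ∀ j : Fin (n + 1), ∀ s ∈ Icc (t j.castSucc) (t j.succ), D s = 0 → 0 < p j := by
    intro j s hs hDs
    by_contra h
    have hpj0 : p j = 0 := le_antisymm (not_lt.1 h) (hp j)
    have hlr := ht.monotone j.castSucc_le_succ
    have h1 := hslope j _ (left_mem_Icc.2 hlr) s hs hs.1
    have h2 := hslope j s hs _ (right_mem_Icc.2 hlr) hs.2
    have h3 : η * (s - t j.castSucc) ≤ η * T :=
      mul_le_mul_of_nonneg_left (by linarith [hlen j, hs.2]) hη.le
    have h4 : η * (t j.succ - s) ≤ η * T :=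
      mul_le_mul_of_nonneg_left (by linarith [hlen j, hs.1]) hη.le
    rw [hpj0, hDs] at h1 h2
    simp only [mul_zero, zero_mul, sub_zero, zero_sub, abs_neg] at h1 h2
    have bound : ∀ k, |D (t k)| ≤ η * T → X k = 0 := by
      intro k hk
      by_contra hXk
      have h5 := hηX k hXk
      have h6 := abs_sub_abs_le_abs_sub (X k) (D (t k))
      rw [abs_sub_comm] at h6
      linarith [hnode k]
    rcases hnonzero j with h5 | h5
    · exact h5 (bound _ (h1.trans h3))
    · exact h5 (bound _ (h2.trans h4))
  have hanti : ∀ j : Fin (n + 1), 0 < p j → StrictAntiOn D (Icc (t j.castSucc) (t j.succ)) := by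
    intro j hj s hs s' hs' hss
    have h1 := (abs_le.1 (hslope j s hs s' hs' hss.le)).1
    have h2 : 0 < (κ * p j - η) * (s' - s) :=
      mul_pos (by linarith [hηp j hj]) (sub_pos.2 hss)
    nlinarith
  have main : ∀ s s' : ℝ, t 0 ≤ s → s' ≤ t (Fin.last (n + 1)) → s < s' → D s = 0 → D s' ≠ 0 := by
    intro s s' hs hs' hss hDs hDs'
    obtain ⟨j, hj⟩ := exists_mem_Icc_castSucc_succ ht.monotone hs (hss.le.trans hs')
    obtain ⟨k, hk⟩ := exists_mem_Icc_castSucc_succ ht.monotone (hs.trans hss.le) hs'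
    have hDj := hanti j (hpj j s hj hDs)
    have hDk := hanti k (hpj k s' hk hDs')
    rcases lt_trichotomy j k with hjk | rfl | hjk
    · have hjk' : j.succ ≤ k.castSucc := Fin.succ_le_castSucc_iff.2 hjk
      have h1 : D (t j.succ) ≤ 0 :=
        hDs ▸ hDj.antitoneOn hj (right_mem_Icc.2 (hj.1.trans hj.2)) hj.2
      have h2 : 0 ≤ D (t k.castSucc) :=
        hDs' ▸ hDk.antitoneOn (left_mem_Icc.2 (hk.1.trans hk.2)) hk hk.1
      have h3 := hneg _ h1
      have h4 := hpos _ h2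
      have h5 := hX hjk'
      rcases hjk'.eq_or_lt with heq | hlt
      · rw [← heq] at h2
        have h6 : s = t j.succ := hDj.injOn hj (right_mem_Icc.2 (hj.1.trans hj.2)) (by linarith)
        have h7 : s' = t k.castSucc :=
          hDk.injOn hk (left_mem_Icc.2 (hk.1.trans hk.2)) (by rw [← heq]; linarith)
        rw [h6, h7, heq] at hss
        exact lt_irrefl _ hss
      · obtain ⟨i, hi⟩ := Fin.exists_castSucc_eq.2 (hlt.trans_le (Fin.le_last _)).ne
        rw [← hi] at hlt h3 h5
        have h6 := hX (Fin.castSucc_lt_iff_succ_le.1 hlt)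
        have h7 := hX i.castSucc_le_succ
        rcases hnonzero i with h | h <;> exact h (by linarith)
    · exact absurd (hDj hj hk hss) (by rw [hDs, hDs']; exact lt_irrefl _)
    · have : k.succ ≤ j.castSucc := Fin.succ_le_castSucc_iff.2 hjk
      linarith [ht.monotone this, hj.1, hk.2]
  rintro s ⟨hs, hDs⟩ s' ⟨hs', hDs'⟩ -
  rcases lt_trichotomy s s' with h | h | h
  · exact absurd hDs' (main s s' hs.1 hs'.2 h hDs)
  · exact h
  · exact absurd hDs (main s' s hs'.1 hs.2 h hDs')

theorem sum_increment_sub_le {n : ℕ} {t : Fin (n + 2) → ℝ} {p : Fin (n + 1) → ℝ}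
    (ht : Monotone t) (hp : ∀ i, 0 ≤ p i) {γ : ℝ → ℝ} {L R η : ℝ}
    (hγR : ∀ u v, 0 ≤ u → u ≤ v → v ≤ t (Fin.last (n + 1)) - t 0 →
      |γ v - γ u - R * (v - u)| ≤ η * (v - u))
    (hγL : ∀ u v, t 0 - t (Fin.last (n + 1)) ≤ u → u ≤ v → v ≤ 0 →
      |γ v - γ u - L * (v - u)| ≤ η * (v - u)) (j : Fin (n + 1)) {s s' : ℝ}
    (hs : t j.castSucc ≤ s) (hss : s ≤ s') (hs' : s' ≤ t j.succ) :
    |(∑ i, p i * (γ (t i.succ - s) - γ (t i.castSucc - s))) -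
      (∑ i, p i * (γ (t i.succ - s') - γ (t i.castSucc - s'))) - (R - L) * p j * (s' - s)| ≤
      η * (2 * ∑ i, p i) * (s' - s) := by
  have h0 : ∀ k, t 0 ≤ t k := fun k => ht (Fin.zero_le _)
  have h1 : ∀ k, t k ≤ t (Fin.last (n + 1)) := fun k => ht (Fin.le_last _)
  have node : ∀ k, |γ (t k - s) - γ (t k - s') - (if k ≤ j.castSucc then L else R) * (s' - s)| ≤
      η * (s' - s) := by
    intro k
    split_ifs with h
    · have h2 := ht h
      have := hγL (t k - s') (t k - s) (by linarith [h0 k, h1 j.succ]) (by linarith) (by linarith)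
      convert this using 2 <;> ring
    · have h2 : t j.succ ≤ t k := ht (Fin.castSucc_lt_iff_succ_le.1 (not_le.1 h))
      have := hγR (t k - s') (t k - s) (by linarith) (by linarith)
        (by linarith [h1 k, h0 j.castSucc])
      convert this using 2 <;> ring
  have jump : (R - L) * p j * (s' - s) = ∑ i, p i *
      (((if i.succ ≤ j.castSucc then L else R) - (if i.castSucc ≤ j.castSucc then L else R)) *
        (s' - s)) := by
    rw [Finset.sum_eq_single j]
    · simp
      ring
    · intro i _ hij
      rcases lt_or_gt_of_ne hij with h | h
      · have h2 : i.castSucc < j.castSucc := Fin.castSucc_lt_castSucc_iff.2 h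
        rw [if_pos (Fin.castSucc_lt_iff_succ_le.1 h2), if_pos h2.le]
        ring
      · have h2 : j.castSucc < i.castSucc := Fin.castSucc_lt_castSucc_iff.2 h
        rw [if_neg (h2.trans Fin.castSucc_lt_succ).not_ge, if_neg h2.not_ge]
        ring
    · simp
  rw [jump, ← Finset.sum_sub_distrib, ← Finset.sum_sub_distrib, Finset.mul_sum, Finset.mul_sum,
    Finset.sum_mul]
  refine (Finset.abs_sum_le_sum_abs _ _).trans (Finset.sum_le_sum fun i _ => ?_)
  rw [← mul_sub, ← mul_sub, abs_mul, abs_of_nonneg (hp i)]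
  calc _ ≤ p i * (η * (s' - s) + η * (s' - s)) := by
        refine mul_le_mul_of_nonneg_left ?_ (hp i)
        refine le_trans (le_of_eq ?_)
          ((abs_sub _ _).trans (add_le_add (node i.succ) (node i.castSucc)))
        congr 1
        ring
    _ = _ := by ring

theorem sum_increment_node_le {n : ℕ} {t : Fin (n + 2) → ℝ} {p : Fin (n + 1) → ℝ}
    (ht : Monotone t) (hp : ∀ i, 0 ≤ p i) {γ : ℝ → ℝ} {L R η : ℝ}
    (hγR : ∀ u v, 0 ≤ u → u ≤ v → v ≤ t (Fin.last (n + 1)) - t 0 →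
      |γ v - γ u - R * (v - u)| ≤ η * (v - u))
    (hγL : ∀ u v, t 0 - t (Fin.last (n + 1)) ≤ u → u ≤ v → v ≤ 0 →
      |γ v - γ u - L * (v - u)| ≤ η * (v - u)) (j : Fin (n + 2)) :
    |(∑ i, p i * (γ (t i.succ - t j) - γ (t i.castSucc - t j))) -
      ∑ i, p i * (t i.succ - t i.castSucc) * (if i.castSucc < j then L else R)| ≤
      η * ∑ i, p i * (t i.succ - t i.castSucc) := by
  rw [← Finset.sum_sub_distrib, Finset.mul_sum]
  refine (Finset.abs_sum_le_sum_abs _ _).trans (Finset.sum_le_sum fun i _ => ?_)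
  rw [mul_assoc, ← mul_sub, abs_mul, abs_of_nonneg (hp i), mul_left_comm]
  refine mul_le_mul_of_nonneg_left ?_ (hp i)
  have h0 : ∀ k, t 0 ≤ t k := fun k => ht (Fin.zero_le _)
  have h1 : ∀ k, t k ≤ t (Fin.last (n + 1)) := fun k => ht (Fin.le_last _)
  have h2 := ht i.castSucc_le_succ
  split_ifs with h
  · have h3 := ht (Fin.castSucc_lt_iff_succ_le.1 h)
    have := hγL (t i.castSucc - t j) (t i.succ - t j) (by linarith [h0 i.castSucc, h1 j])
      (by linarith) (by linarith)
    rwa [sub_sub_sub_cancel_right, mul_comm L] at this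
  · have h3 := ht (not_lt.1 h)
    have := hγR (t i.castSucc - t j) (t i.succ - t j) (by linarith)
      (by linarith) (by linarith [h1 i.succ, h0 j])
    rwa [sub_sub_sub_cancel_right, mul_comm R] at this

theorem abs_image_sub_sub_mul_le {f : ℝ → ℝ} {a b c η : ℝ} (hf : ContinuousOn f (Icc a b))
    (hd : ∀ x ∈ Ioo a b, DifferentiableAt ℝ f x ∧ |deriv f x - c| ≤ η) {u v : ℝ}
    (hu : a ≤ u) (huv : u ≤ v) (hv : v ≤ b) : |f v - f u - c * (v - u)| ≤ η * (v - u) := by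
  have hd' : DifferentiableOn ℝ f (interior (Icc a b)) := by
    rw [interior_Icc]
    exact fun x hx => (hd x hx).1.differentiableWithinAt
  have hu' : u ∈ Icc a b := ⟨hu, huv.trans hv⟩
  have hv' : v ∈ Icc a b := ⟨hu.trans huv, hv⟩
  have h1 := (convex_Icc a b).image_sub_le_mul_sub_of_deriv_le hf hd' (C := c + η)
    (fun x hx => by linarith [(abs_le.1 (hd x (by rwa [interior_Icc] at hx)).2).2]) u hu' v hv' huv
  have h2 := (convex_Icc a b).mul_sub_le_image_sub_of_le_deriv hf hd' (C := c - η)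
    (fun x hx => by linarith [(abs_le.1 (hd x (by rwa [interior_Icc] at hx)).2).1]) u hu' v hv' huv
  rw [abs_le]
  constructor <;> linarith

theorem exists_isValley_of_hasDerivAt {F P : ℝ → ℝ} {c α r : ℝ} (hc : 0 < c) (hα : 0 < α)
    (hαr : α < r) (hF : ∀ x, HasDerivAt F (c * P x) x) (hP : Continuous P)
    (hneg : ∀ x ∈ Icc (-r) (-α), P x < 0) (hpos : ∀ x ∈ Icc α r, 0 < P x)
    (hinj : ∀ x ∈ Icc (-α) α, ∀ y ∈ Icc (-α) α, P x = 0 → P y = 0 → x = y) :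
    ∃ m ∈ Icc (-α) α, StrictAntiOn F (Icc (-r) m) ∧ StrictMonoOn F (Icc m r) := by
  have hα1 := hneg (-α) ⟨by linarith, le_rfl⟩
  have hα2 := hpos α ⟨le_rfl, hαr.le⟩
  have hFc : Continuous F := continuous_iff_continuousAt.2 fun x => (hF x).continuousAt
  obtain ⟨m, hm, hPm⟩ := intermediate_value_Icc (by linarith : -α ≤ α) hP.continuousOn
    ⟨hα1.le, hα2.le⟩
  refine ⟨m, hm, strictAntiOn_of_deriv_neg (convex_Icc _ _) hFc.continuousOn fun x hx => ?_,
    strictMonoOn_of_deriv_pos (convex_Icc _ _) hFc.continuousOn fun x hx => ?_⟩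
  · rw [interior_Icc] at hx
    rw [(hF x).deriv]
    refine mul_neg_of_pos_of_neg hc ?_
    by_contra! h
    rcases le_or_gt x (-α) with h1 | h1
    · exact h.not_gt (hneg x ⟨hx.1.le, h1⟩)
    · obtain ⟨y, hy, hPy⟩ := intermediate_value_Icc h1.le hP.continuousOn ⟨hα1.le, h⟩
      have := hinj y ⟨hy.1, by linarith [hy.2, hx.2, hm.2]⟩ m hm hPy hPm
      linarith [hy.2, hx.2]
  · rw [interior_Icc] at hx
    rw [(hF x).deriv]
    refine mul_pos hc ?_
    by_contra! h
    rcases le_or_gt α x with h1 | h1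
    · exact h.not_gt (hpos x ⟨h1, hx.2.le⟩)
    · obtain ⟨y, hy, hPy⟩ := intermediate_value_Icc h1.le hP.continuousOn ⟨h, hα2.le⟩
      have := hinj y ⟨by linarith [hy.1, hx.1, hm.1], hy.2⟩ m hm hPy hPm
      linarith [hy.1, hx.1]

theorem PiecewiseDiffOn.eventually_differentiableAt {f : ℝ → ℝ} {a b c : ℝ} {S : Set ℝ}
    (hf : PiecewiseDiffOn 1 f a b S) (hc : c ∈ Ioo a b) :
    ∀ᶠ x in nhdsWithin c {c}ᶜ, DifferentiableAt ℝ f x := by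
  obtain ⟨-, hS, -, hdiff, -⟩ := hf
  have h1 : ∀ᶠ x in nhds c, x ∈ Ioo a b := Ioo_mem_nhds hc.1 hc.2
  have h2 : ∀ᶠ x in nhds c, x ∉ S \ {c} :=
    (hS.subset sdiff_subset).isClosed.isOpen_compl.mem_nhds (by simp)
  filter_upwards [mem_nhdsWithin_of_mem_nhds h1, mem_nhdsWithin_of_mem_nhds h2,
    self_mem_nhdsWithin] with x hx1 hx2 hx3
  have hxS : x ∉ S := fun h => hx2 ⟨h, hx3⟩
  refine (hdiff.differentiableOn (by simp)).differentiableAt ?_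
  exact inter_mem (Icc_mem_nhds hx1.1 hx1.2) (hS.isClosed.isOpen_compl.mem_nhds hxS)

theorem LR_averaging_stability
    (n : ℕ) (t : Fin (n + 2) → ℝ) (p : Fin (n + 1) → ℝ)
    (ht : StrictMono t) (ht0 : t 0 = -1) (htlast : t (Fin.last (n + 1)) = 1)
    (hp : ∀ i, 0 ≤ p i)
    (hsum : ∑ i : Fin (n + 1), (t i.succ - t i.castSucc) * p i = 1)
    (ε : ℝ) (hε : 0 < ε) (g : ℝ → ℝ) (S : Set ℝ)
    (hgpw : PiecewiseDiffOn 1 g (-ε) ε S)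
    (hgdec : StrictAntiOn g (Icc (-ε) 0)) (hginc : StrictMonoOn g (Icc 0 ε))
    (L R : ℝ)
    (hL : Tendsto (deriv g) (nhdsWithin 0 (Iio 0)) (nhds L))
    (hR : Tendsto (deriv g) (nhdsWithin 0 (Ioi 0)) (nhds R))
    (X : Fin (n + 2) → ℝ)
    (hX : ∀ i, X i =
      L * (stepMeasure n t p (Icc (-1) (t i))).toReal +
      R * (stepMeasure n t p (Icc (t i) 1)).toReal)
    (hnonzero : ∀ i : Fin (n + 1), X i.castSucc ≠ 0 ∨ X i.succ ≠ 0) :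
    TopStableAt (stepMeasure n t p) g 0 := by
  have hgc := hgpw.1
  have hdiff := hgpw.eventually_differentiableAt (c := 0) ⟨by linarith, hε⟩
  have htI : ∀ k, t k ∈ Icc (-1 : ℝ) 1 := fun k =>
    ⟨ht0 ▸ ht.monotone (Fin.zero_le _), htlast ▸ ht.monotone (Fin.le_last _)⟩
  have hsum' : ∑ i : Fin (n + 1), p i * (t i.succ - t i.castSucc) = 1 := by
    rw [← hsum]
    exact Finset.sum_congr rfl fun i _ => mul_comm _ _
  obtain ⟨i₀, hi₀⟩ : ∃ i, 0 < p i := by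
    by_contra! h
    have : ∀ i, p i = 0 := fun i => le_antisymm (h i) (hp i)
    simp [this] at hsum
  have hL0 : L ≤ 0 := by
    refine le_of_tendsto hL ?_
    filter_upwards [Ioo_mem_nhdsLT (by linarith : -ε < 0)] with x hx
    rw [← derivWithin_of_mem_nhds (Icc_mem_nhds hx.1 hx.2)]
    exact hgdec.antitoneOn.derivWithin_nonpos
  have hR0 : 0 ≤ R := by
    refine ge_of_tendsto hR ?_
    filter_upwards [Ioo_mem_nhdsGT hε] with x hx
    rw [← derivWithin_of_mem_nhds (Icc_mem_nhds hx.1 hx.2)]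
    exact hginc.monotoneOn.derivWithin_nonneg
  have hLR : L < R := by
    refine lt_of_le_of_ne (hL0.trans hR0) fun h => ?_
    have hl : L = 0 := le_antisymm hL0 (h ▸ hR0)
    have hX0 : ∀ i, X i = 0 := fun i => by rw [hX, ← h, hl]; ring
    rcases hnonzero 0 with h | h <;> exact h (hX0 _)
  have hX' : ∀ j, X j = ∑ i, p i * (t i.succ - t i.castSucc) *
      (if i.castSucc < j then L else R) := by
    intro j
    rw [hX, ← ht0, ← htlast, toReal_stepMeasure_Icc_left n t p ht hp,
      toReal_stepMeasure_Icc_right n t p ht hp, Finset.mul_sum, Finset.mul_sum,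
      ← Finset.sum_add_distrib]
    refine Finset.sum_congr rfl fun i _ => ?_
    split_ifs <;> ring
  have hXanti : Antitone X := by
    intro j k hjk
    rw [hX', hX']
    refine Finset.sum_le_sum fun i _ => mul_le_mul_of_nonneg_left ?_
      (mul_nonneg (hp i) (sub_nonneg.2 (ht.monotone i.castSucc_le_succ)))
    split_ifs with h1 h2 h2
    · exact le_rfl
    · exact hLR.le
    · exact absurd (h2.trans_le hjk) h1
    · exact le_rfl
  obtain ⟨η, hη, huniq⟩ := exists_pos_forall_zero_unique ht hp (sub_pos.2 hLR) hXanti hnonzero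
  have hpsum : 0 ≤ ∑ i, p i := Finset.sum_nonneg fun i _ => hp i
  obtain ⟨η', hη', hη1, hη2⟩ : ∃ η' > 0, η' * (2 * ∑ i, p i) ≤ η ∧ η' ≤ η := by
    refine ⟨η / (2 * ∑ i, p i + 1), by positivity, ?_, div_le_self hη.le (by linarith)⟩
    rw [div_mul_eq_mul_div, div_le_iff₀ (by positivity)]
    exact mul_le_mul_of_nonneg_left (by linarith) hη.le
  obtain ⟨δ₁, hδ₁, hδ₁'⟩ : ∃ δ ∈ Iio (0 : ℝ), Ioo δ 0 ⊆
      {x | DifferentiableAt ℝ g x ∧ |deriv g x - L| ≤ η'} := by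
    refine (mem_nhdsLT_iff_exists_Ioo_subset).1 ?_
    filter_upwards [hdiff.filter_mono (nhdsWithin_mono _ fun x hx => ne_of_lt hx),
      hL (Metric.closedBall_mem_nhds L hη')] with x hx1 hx2
    exact ⟨hx1, hx2⟩
  obtain ⟨δ₂, hδ₂, hδ₂'⟩ : ∃ δ ∈ Ioi (0 : ℝ), Ioo 0 δ ⊆
      {x | DifferentiableAt ℝ g x ∧ |deriv g x - R| ≤ η'} := by
    refine (mem_nhdsGT_iff_exists_Ioo_subset).1 ?_
    filter_upwards [hdiff.filter_mono (nhdsWithin_mono _ fun x hx => ne_of_gt hx),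
      hR (Metric.closedBall_mem_nhds R hη')] with x hx1 hx2
    exact ⟨hx1, hx2⟩
  obtain ⟨r, hr, hr'⟩ : ∃ r > 0, r < min (ε / 2) (min (-δ₁ / 2) (δ₂ / 2)) :=
    exists_between (by simp_all)
  simp only [lt_min_iff] at hr'
  refine ⟨r, hr, fun α hα => ?_⟩
  have hα0 := hα.1
  have hαr := hα.2
  have htα : ∀ k, -α ≤ t k * α ∧ t k * α ≤ α := fun k =>
    ⟨by nlinarith [(htI k).1], by nlinarith [(htI k).2]⟩
  have hgR : ∀ u v, 0 ≤ u → u ≤ v → v ≤ 2 * α → |g v - g u - R * (v - u)| ≤ η' * (v - u) :=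
    fun u v hu huv hv => abs_image_sub_sub_mul_le (a := 0) (b := 2 * α)
      (hgc.mono (Icc_subset_Icc (by linarith) (by linarith)))
      (fun x hx => hδ₂' ⟨hx.1, by linarith [hx.2]⟩) hu huv hv
  have hgL : ∀ u v, -(2 * α) ≤ u → u ≤ v → v ≤ 0 → |g v - g u - L * (v - u)| ≤ η' * (v - u) :=
    fun u v hu huv hv => abs_image_sub_sub_mul_le (a := -(2 * α)) (b := 0)
      (hgc.mono (Icc_subset_Icc (by linarith) (by linarith)))
      (fun x hx => hδ₁' ⟨by linarith [hx.1], hx.2⟩) hu huv hv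
  have hscale : ∀ u v c : ℝ, |g (v * α) - g (u * α) - c * (v * α - u * α)| ≤
      η' * (v * α - u * α) →
      |α⁻¹ * g (v * α) - α⁻¹ * g (u * α) - c * (v - u)| ≤ η' * (v - u) := by
    intro u v c h
    have h1 : α⁻¹ * g (v * α) - α⁻¹ * g (u * α) - c * (v - u) =
        α⁻¹ * (g (v * α) - g (u * α) - c * (v * α - u * α)) := by
      field_simp
    rw [h1, abs_mul, abs_of_pos (inv_pos.2 hα0), inv_mul_le_iff₀ hα0]
    linarith
  have hγR : ∀ u v, 0 ≤ u → u ≤ v → v ≤ t (Fin.last (n + 1)) - t 0 →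
      |α⁻¹ * g (v * α) - α⁻¹ * g (u * α) - R * (v - u)| ≤ η' * (v - u) := by
    intro u v hu huv hv
    rw [ht0, htlast] at hv
    exact hscale u v R (hgR _ _ (by positivity) (by gcongr) (by gcongr; linarith))
  have hγL : ∀ u v, t 0 - t (Fin.last (n + 1)) ≤ u → u ≤ v → v ≤ 0 →
      |α⁻¹ * g (v * α) - α⁻¹ * g (u * α) - L * (v - u)| ≤ η' * (v - u) := by
    intro u v hu huv hv
    rw [ht0, htlast] at hu
    exact hscale u v L (hgL _ _ (by nlinarith) (by gcongr) (by nlinarith))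
  have hinj := huniq
    (fun s => ∑ i, p i * (α⁻¹ * g ((t i.succ - s) * α) - α⁻¹ * g ((t i.castSucc - s) * α)))
    (fun j => by
      rw [hX']
      refine (sum_increment_node_le ht.monotone hp (γ := fun u => α⁻¹ * g (u * α))
        hγR hγL j).trans ?_
      rwa [hsum', mul_one])
    (fun j s hs s' hs' hss =>
      (sum_increment_sub_le ht.monotone hp (γ := fun u => α⁻¹ * g (u * α)) hγR hγL j hs.1 hss
        hs'.2).trans (mul_le_mul_of_nonneg_right hη1 (sub_nonneg.2 hss)))
  have hεε : -ε ≤ ε := by linarith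
  set G : ℝ → ℝ := IccExtend hεε ((Icc (-ε) ε).domRestrict g) with hG
  have hGc : Continuous G := (continuousOn_iff_continuous_domRestrict.1 hgc).Icc_extend'
  have hGg : ∀ x, -(2 * r) ≤ x → x ≤ 2 * r → G x = g x := fun x h1 h2 =>
    IccExtend_of_mem hεε _ (show x ∈ Icc (-ε) ε from ⟨by linarith, by linarith⟩)
  have hnode : ∀ i : Fin (n + 1), t i.castSucc * α < t i.succ * α := fun i =>
    mul_lt_mul_of_pos_right (ht i.castSucc_lt_succ) hα0
  obtain ⟨m, hm, hmanti, hmmono⟩ := exists_isValley_of_hasDerivAt (inv_pos.2 hα0) hα0 hαr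
    (hasDerivAt_sum_integral n t p hGc hα0.ne')
    (by fun_prop)
    (fun x hx => by
      have hlt : ∀ i : Fin (n + 1), G (x + t i.succ * α) - G (x + t i.castSucc * α) < 0 := by
        intro i
        have h1 := htα i.castSucc
        have h2 := htα i.succ
        have h3 := hnode i
        rw [hGg _ (by linarith [hx.1]) (by linarith [hx.2]),
          hGg _ (by linarith [hx.1]) (by linarith [hx.2]), sub_neg]
        exact hgdec ⟨by linarith [hx.1], by linarith [hx.2]⟩
          ⟨by linarith [hx.1], by linarith [hx.2]⟩ (by linarith)
      exact Finset.sum_neg' (fun i _ => mul_nonpos_of_nonneg_of_nonpos (hp i) (hlt i).le)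
        ⟨i₀, Finset.mem_univ _, mul_neg_of_pos_of_neg hi₀ (hlt i₀)⟩)
    (fun x hx => by
      have hlt : ∀ i : Fin (n + 1), 0 < G (x + t i.succ * α) - G (x + t i.castSucc * α) := by
        intro i
        have h1 := htα i.castSucc
        have h2 := htα i.succ
        have h3 := hnode i
        rw [hGg _ (by linarith [hx.1]) (by linarith [hx.2]),
          hGg _ (by linarith [hx.1]) (by linarith [hx.2]), sub_pos]
        exact hginc ⟨by linarith [hx.1], by linarith [hx.2]⟩
          ⟨by linarith [hx.1], by linarith [hx.2]⟩ (by linarith)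
      exact Finset.sum_pos' (fun i _ => mul_nonneg (hp i) (hlt i).le)
        ⟨i₀, Finset.mem_univ _, mul_pos hi₀ (hlt i₀)⟩)
    (fun x hx y hy hPx hPy => by
      have hmem : ∀ z ∈ Icc (-α) α,
          ∑ i, p i * (G (z + t i.succ * α) - G (z + t i.castSucc * α)) = 0 →
          -z / α ∈ Icc (t 0) (t (Fin.last (n + 1))) ∩ {s | ∑ i, p i *
            (α⁻¹ * g ((t i.succ - s) * α) - α⁻¹ * g ((t i.castSucc - s) * α)) = 0} := by
        intro z hz hPz
        refine ⟨?_, ?_⟩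
        · rw [ht0, htlast, mem_Icc, le_div_iff₀ hα0, div_le_iff₀ hα0]
          constructor <;> linarith [hz.1, hz.2]
        · have hterm : ∀ k, g ((t k - -z / α) * α) = G (z + t k * α) := by
            intro k
            have h1 := htα k
            rw [hGg _ (by linarith [hz.1]) (by linarith [hz.2])]
            congr 1
            field_simp
            ring
          simp only [mem_ofPred_eq, hterm, ← mul_sub, mul_left_comm _ α⁻¹]
          rw [← Finset.mul_sum, hPz, mul_zero]
      have h := hinj (hmem x hx hPx) (hmem y hy hPy)
        ((hmem x hx hPx).2.trans (hmem y hy hPy).2.symm)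
      rwa [div_left_inj' hα0.ne', neg_inj] at h)
  have havg : ∀ x ∈ Icc (-r) r, ∑ i, p i * ∫ s in t i.castSucc..t i.succ, G (x + s * α) =
      avg (stepMeasure n t p) g α x := by
    intro x hx
    have hmem : ∀ s ∈ Icc (-1 : ℝ) 1, -(2 * r) ≤ x + s * α ∧ x + s * α ≤ 2 * r := fun s hs =>
      ⟨by nlinarith [hs.1, hx.1], by nlinarith [hs.2, hx.2]⟩
    rw [avg, integral_stepMeasure n t p ht.monotone hp]
    · refine Finset.sum_congr rfl fun i _ => ?_
      congr 1
      refine intervalIntegral.integral_congr fun s hs => ?_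
      rw [uIcc_of_le (ht.monotone i.castSucc_le_succ)] at hs
      have := hmem s ⟨(htI _).1.trans hs.1, hs.2.trans (htI _).2⟩
      exact hGg _ this.1 this.2
    · rw [ht0, htlast]
      refine hgc.comp (by fun_prop) fun s hs => ?_
      have := hmem s hs
      exact ⟨by linarith, by linarith⟩
  have hvg : IsValleyOn g 0 r := by
    refine ⟨hgc.mono ?_, hgdec.mono ?_, hginc.mono ?_⟩ <;>
    exact Icc_subset_Icc (by linarith) (by linarith)
  have hva : IsValleyOn (avg (stepMeasure n t p) g α) m (r - α) := by
    have hl : -r ≤ m - (r - α) := by linarith [hm.1]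
    have hu : m + (r - α) ≤ r := by linarith [hm.2]
    have hml : -r ≤ m := by linarith
    have hmu : m ≤ r := by linarith
    refine ⟨?_, ?_, ?_⟩
    · refine ContinuousOn.congr (f := fun x => ∑ i, p i * ∫ s in t i.castSucc..t i.succ,
        G (x + s * α)) (fun x _ => ?_) fun x hx => (havg x ⟨hl.trans hx.1, hx.2.trans hu⟩).symm
      exact (hasDerivAt_sum_integral n t p hGc hα0.ne' x).continuousAt.continuousWithinAt
    · exact (hmanti.mono (Icc_subset_Icc_left hl)).congr fun x hx =>
        havg x ⟨hl.trans hx.1, hx.2.trans hmu⟩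
    · exact (hmmono.mono (Icc_subset_Icc_right hu)).congr fun x hx =>
        havg x ⟨hml.trans hx.1, hx.2.trans hu⟩
  obtain ⟨c₁, hc₁, c₂, hc₂, d₁, hd₁, d₂, hd₂, heq⟩ :=
    hvg.exists_topEquivOn hr (sub_pos.2 hαr) hva
  simp only [mem_Ioo] at hc₁ hc₂ hd₁ hd₂ hm
  obtain ⟨hm1, hm2⟩ := hm
  refine ⟨c₁, c₂, d₁, d₂, ⟨?_, ?_⟩, ⟨?_, ?_⟩, ⟨?_, ?_⟩, ⟨?_, ?_⟩, ?_, ?_, ?_, heq⟩ <;> linarith
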